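/- Let N ≥ 1, let V : ℝ^N → ℝ be bounded and measurable, and suppose there exist R > 0 and c > 0 with V(x) ≥ c for every |x| ≥ R. Let φ : ℝ^N → ℝ be twice continuously differentiable with φ(x) > 0 for all x, with φ ∈ L², |∇φ| ∈ L², and −Δφ(x) + V(x)φ(x) = 0 for all x ∈ ℝ^N. Then: (i) for every continuously differentiable v : ℝ^N → ℝ with v ∈ L² and |∇v| ∈ L², one has ∫(|∇v|² + V·v²) dx ≥ 0; (ii) if moreover v is twice continuously differentiable and satisfies −Δv + Vv = 0 on ℝ^N, then v is a scalar multiple of φ; (iii) there exists λ > 0 such that for every v as in (i): ∫(|∇v|² + V·v²) dx ≤ (1/λ)·∫(v² + |∇v|²) dx and ∫(|∇v|² + V·v²) dx ≥ 4λ·∫(v² + |∇v|²) dx − (1/λ)·(∫ vφ dx)²; and for every twice continuously differentiable v with v, |∇v|, Δv ∈ L²: ∫(−Δv + Vv)² dx ≥ 4λ·∫(v² + |∇v|² + (Δv)²) dx − (1/λ)·(∫ vφ dx)². -/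

import Mathlib

open MeasureTheory Filter ENNReal

noncomputable section

/-- the Laplacian of a function on ℝ^N, as the sum of the second partial derivatives in
    the directions of the canonical basis -/
def lap {N : ℕ} (f : EuclideanSpace ℝ (Fin N) → ℝ) (x : EuclideanSpace ℝ (Fin N)) : ℝ :=
  ∑ i : Fin N,
    fderiv ℝ (fun y => fderiv ℝ f y (EuclideanSpace.single i 1)) x (EuclideanSpace.single i 1)

namespace SchrCoer


variable {N : ℕ}

lemma grad_mul {f g : (EuclideanSpace ℝ (Fin N)) → ℝ} {x : EuclideanSpace ℝ (Fin N)} (hf : DifferentiableAt ℝ f x)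
    (hg : DifferentiableAt ℝ g x) :
    gradient (fun y => f y * g y) x = f x • gradient g x + g x • gradient f x := by
  unfold gradient
  rw [fderiv_fun_mul hf hg]
  simp

lemma grad_sub {f g : (EuclideanSpace ℝ (Fin N)) → ℝ} {x : EuclideanSpace ℝ (Fin N)} (hf : DifferentiableAt ℝ f x)
    (hg : DifferentiableAt ℝ g x) :
    gradient (fun y => f y - g y) x = gradient f x - gradient g x := by
  unfold gradient
  rw [fderiv_fun_sub hf hg]
  simp

lemma cont_grad {f : (EuclideanSpace ℝ (Fin N)) → ℝ} (hf : ContDiff ℝ 1 f) : Continuous (gradient f) := by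
  unfold gradient
  exact (LinearIsometryEquiv.continuous _).comp (hf.continuous_fderiv one_ne_zero)

lemma cs_grad {f : (EuclideanSpace ℝ (Fin N)) → ℝ} (hf : HasCompactSupport f) : HasCompactSupport (gradient f) := by
  have := hf.fderiv (𝕜 := ℝ)
  unfold gradient
  exact this.comp_left (g := (InnerProductSpace.toDual ℝ (EuclideanSpace ℝ (Fin N))).symm) (by simp)

lemma norm_grad (f : (EuclideanSpace ℝ (Fin N)) → ℝ) (x : EuclideanSpace ℝ (Fin N)) : ‖gradient f x‖ = ‖fderiv ℝ f x‖ := by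
  unfold gradient; simp

lemma sum_fderiv (f g : (EuclideanSpace ℝ (Fin N)) → ℝ) (x : EuclideanSpace ℝ (Fin N)) :
    ∑ i, fderiv ℝ f x (EuclideanSpace.single i 1) * fderiv ℝ g x (EuclideanSpace.single i 1)
      = inner ℝ (gradient f x) (gradient g x) := by
  rw [← (EuclideanSpace.basisFun (Fin N) ℝ).sum_inner_mul_inner]
  refine Finset.sum_congr rfl fun i _ => ?_
  rw [inner_gradient_left, real_inner_comm, inner_gradient_left]
  simp

lemma lap_sub {f g : (EuclideanSpace ℝ (Fin N)) → ℝ} (hf : ContDiff ℝ 2 f) (hg : ContDiff ℝ 2 g) (x : EuclideanSpace ℝ (Fin N)) :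
    lap (fun y => f y - g y) x = lap f x - lap g x := by
  unfold lap
  rw [← Finset.sum_sub_distrib]
  refine Finset.sum_congr rfl fun i _ => ?_
  have h1 : (fun y => fderiv ℝ (fun y => f y - g y) y (EuclideanSpace.single i 1))
      = fun y => fderiv ℝ f y (EuclideanSpace.single i 1)
        - fderiv ℝ g y (EuclideanSpace.single i 1) := by
    ext y
    rw [fderiv_fun_sub (hf.differentiable two_ne_zero y) (hg.differentiable two_ne_zero y)]
    simp
  have h2 : ∀ {f : (EuclideanSpace ℝ (Fin N)) → ℝ}, ContDiff ℝ 2 f → DifferentiableAt ℝ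
      (fun y => fderiv ℝ f y (EuclideanSpace.single i 1)) x := by
    intro f hf
    have : ContDiff ℝ 1 (fderiv ℝ f) := hf.fderiv_right (by norm_num)
    exact (this.clm_apply contDiff_const).differentiable one_ne_zero x
  rw [h1, fderiv_fun_sub (h2 hf) (h2 hg)]
  simp

lemma lap_const_mul {f : (EuclideanSpace ℝ (Fin N)) → ℝ} (hf : ContDiff ℝ 2 f) (a : ℝ) (x : EuclideanSpace ℝ (Fin N)) :
    lap (fun y => a * f y) x = a * lap f x := by
  unfold lap
  rw [Finset.mul_sum]
  refine Finset.sum_congr rfl fun i _ => ?_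
  have h1 : (fun y => fderiv ℝ (fun y => a * f y) y (EuclideanSpace.single i 1))
      = fun y => a * fderiv ℝ f y (EuclideanSpace.single i 1) := by
    ext y
    rw [fderiv_const_mul (hf.differentiable two_ne_zero y)]
    simp
  have h2 : DifferentiableAt ℝ
      (fun y => fderiv ℝ f y (EuclideanSpace.single i 1)) x := by
    have : ContDiff ℝ 1 (fderiv ℝ f) := hf.fderiv_right (by norm_num)
    exact (this.clm_apply contDiff_const).differentiable one_ne_zero x
  rw [h1, fderiv_const_mul h2]
  simp

lemma cont_lap {f : (EuclideanSpace ℝ (Fin N)) → ℝ} (hf : ContDiff ℝ 2 f) : Continuous (lap f) := by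
  unfold lap
  refine continuous_finsetSum _ fun i _ => ?_
  have : ContDiff ℝ 1 (fderiv ℝ f) := hf.fderiv_right (by norm_num)
  have h := (this.clm_apply (contDiff_const (c := (EuclideanSpace.single i 1 : EuclideanSpace ℝ (Fin N)))))
  exact (h.continuous_fderiv one_ne_zero).clm_apply continuous_const

/-- integration by parts against a compactly supported function -/
lemma ibp {u ψ : (EuclideanSpace ℝ (Fin N)) → ℝ} (hu : ContDiff ℝ 2 u) (hψ : ContDiff ℝ 1 ψ)
    (hc : HasCompactSupport ψ) :
    ∫ x, ψ x * lap u x = - ∫ x, inner ℝ (gradient ψ x) (gradient u x) := by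
  have hu1 : ContDiff ℝ 1 u := hu.of_le (by norm_num)
  have hd : ∀ i : Fin N, ContDiff ℝ 1 (fun y => fderiv ℝ u y (EuclideanSpace.single i 1)) := by
    intro i
    have : ContDiff ℝ 1 (fderiv ℝ u) := hu.fderiv_right (by norm_num)
    exact this.clm_apply contDiff_const
  have c1 : ∀ i : Fin N, Continuous (fun y => fderiv ℝ ψ y (EuclideanSpace.single i 1)) :=
    fun i => (hψ.continuous_fderiv one_ne_zero).clm_apply continuous_const
  have c2 : ∀ i : Fin N, Continuous (fun y => fderiv ℝ (fun y => fderiv ℝ u y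
      (EuclideanSpace.single i 1)) y (EuclideanSpace.single i 1)) :=
    fun i => ((hd i).continuous_fderiv one_ne_zero).clm_apply continuous_const
  have s1 : ∀ i : Fin N, HasCompactSupport (fun y => fderiv ℝ ψ y (EuclideanSpace.single i 1)) :=
    fun i => hc.fderiv_apply (𝕜 := ℝ) _
  have i1 : ∀ i : Fin N, Integrable (fun y => fderiv ℝ ψ y (EuclideanSpace.single i 1) *
      fderiv ℝ u y (EuclideanSpace.single i 1)) := fun i =>
    ((c1 i).mul (hd i).continuous).integrable_of_hasCompactSupport (s1 i).mul_right
  have i2 : ∀ i : Fin N, Integrable (fun y => ψ y * fderiv ℝ (fun y => fderiv ℝ u y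
      (EuclideanSpace.single i 1)) y (EuclideanSpace.single i 1)) := fun i =>
    (hψ.continuous.mul (c2 i)).integrable_of_hasCompactSupport hc.mul_right
  have i3 : ∀ i : Fin N, Integrable (fun y => ψ y * fderiv ℝ u y
      (EuclideanSpace.single i 1)) := fun i =>
    (hψ.continuous.mul (hd i).continuous).integrable_of_hasCompactSupport hc.mul_right
  simp_rw [← sum_fderiv, lap, Finset.mul_sum]
  rw [integral_finsetSum _ fun i _ => i2 i, integral_finsetSum _ fun i _ => i1 i,
    ← Finset.sum_neg_distrib]
  refine Finset.sum_congr rfl fun i _ => ?_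
  exact integral_mul_fderiv_eq_neg_fderiv_mul_of_integrable (i1 i) (i2 i) (i3 i)
    (fun x _ => hψ.differentiable one_ne_zero x)
    (fun x _ => (hd i).differentiable one_ne_zero x)

lemma bump_facts (r : ℝ) (hr : 0 < r) : ∃ b : (EuclideanSpace ℝ (Fin N)) → ℝ, ∃ C : ℝ, 0 ≤ C ∧ ContDiff ℝ 1 b ∧
    HasCompactSupport b ∧ (∀ x, 0 ≤ b x ∧ b x ≤ 1) ∧ (∀ x, ‖gradient b x‖ ≤ C) ∧
    (∀ x, ‖x‖ ≤ r → b x = 1) ∧ (∀ x, 3 * r ≤ ‖x‖ → b x = 0) ∧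
    (∀ x, ‖x‖ < r → gradient b x = 0) ∧ (∀ x, 3 * r ≤ ‖x‖ → gradient b x = 0) := by
  let b : ContDiffBump (0 : EuclideanSpace ℝ (Fin N)) := ⟨r, 2 * r, hr, by linarith⟩
  have hb : ContDiff ℝ 1 (b : (EuclideanSpace ℝ (Fin N)) → ℝ) := b.contDiff
  obtain ⟨C, hC⟩ := (cont_grad hb).bounded_above_of_compact_support (cs_grad b.hasCompactSupport)
  refine ⟨b, C, (norm_nonneg _).trans (hC 0), hb, b.hasCompactSupport,
    fun x => ⟨b.nonneg, b.le_one⟩, hC, ?_, ?_, ?_, ?_⟩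
  · intro x hx
    exact b.one_of_mem_closedBall (by simpa [b] using hx)
  · intro x hx
    exact b.zero_of_le_dist (by simp [b]; linarith)
  · intro x hx
    have : (b : (EuclideanSpace ℝ (Fin N)) → ℝ) =ᶠ[nhds x] fun _ => 1 := by
      filter_upwards [Metric.isOpen_ball.mem_nhds (show x ∈ Metric.ball (0 : EuclideanSpace ℝ (Fin N)) r by simpa using hx)]
        with y hy
      exact b.one_of_mem_closedBall (Metric.ball_subset_closedBall hy)
    unfold gradient
    rw [this.fderiv_eq]; simp
  · intro x hx
    have : x ∉ tsupport (b : (EuclideanSpace ℝ (Fin N)) → ℝ) := by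
      rw [b.tsupport_eq]; simp [b]; linarith
    have h2 : fderiv ℝ (b : (EuclideanSpace ℝ (Fin N)) → ℝ) x = 0 := by
      by_contra h
      exact this (support_fderiv_subset ℝ (Function.mem_support.2 h))
    unfold gradient
    rw [h2]; simp

lemma exists_cutoff : ∃ χ : ℕ → (EuclideanSpace ℝ (Fin N)) → ℝ, ∃ C : ℝ, 0 ≤ C ∧ (∀ n, ContDiff ℝ 1 (χ n)) ∧
    (∀ n, HasCompactSupport (χ n)) ∧ (∀ n x, 0 ≤ χ n x ∧ χ n x ≤ 1) ∧
    (∀ n x, ‖gradient (χ n) x‖ ≤ C) ∧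
    (∀ x, ∀ᶠ n in atTop, χ n x = 1 ∧ gradient (χ n) x = 0) := by
  obtain ⟨b, C, hC0, hb, hbc, hb01, hbC, hb1, -, hbg, -⟩ := bump_facts (N := N) 1 one_pos
  have hg : ∀ (n : ℕ) x, gradient (fun x => b (((n : ℝ) + 1)⁻¹ • x)) x
      = ((n : ℝ) + 1)⁻¹ • gradient b (((n : ℝ) + 1)⁻¹ • x) := by
    intro n x
    have h1 : HasFDerivAt b (fderiv ℝ b (((n : ℝ) + 1)⁻¹ • x)) (((n : ℝ) + 1)⁻¹ • x) :=
      (hb.differentiable one_ne_zero _).hasFDerivAt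
    have h2 : HasFDerivAt (fun x : EuclideanSpace ℝ (Fin N) => ((n : ℝ) + 1)⁻¹ • x)
      (((n : ℝ) + 1)⁻¹ • ContinuousLinearMap.id ℝ (EuclideanSpace ℝ (Fin N))) x :=
      (((n : ℝ) + 1)⁻¹ • ContinuousLinearMap.id ℝ (EuclideanSpace ℝ (Fin N))).hasFDerivAt
    have h3 := h1.comp x h2
    unfold gradient
    have h4 : fderiv ℝ (fun x => b (((n : ℝ) + 1)⁻¹ • x)) x
      = ((n : ℝ) + 1)⁻¹ • fderiv ℝ b (((n : ℝ) + 1)⁻¹ • x) := by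
      rw [show (fun x => b (((n : ℝ) + 1)⁻¹ • x)) = b ∘ (fun x => ((n : ℝ) + 1)⁻¹ • x) from rfl,
        h3.fderiv]
      ext y; simp
    rw [h4]; simp
  refine ⟨fun n x => b (((n : ℝ) + 1)⁻¹ • x), C, hC0, ?_, ?_, ?_, ?_, ?_⟩
  · intro n; exact hb.comp (contDiff_const_smul _)
  · intro n
    exact hbc.comp_smul (by positivity)
  · intro n x; exact hb01 _
  · intro n x
    rw [hg, norm_smul]
    have : ‖((n : ℝ) + 1)⁻¹‖ ≤ 1 := by
      rw [Real.norm_of_nonneg (by positivity)]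
      exact inv_le_one_of_one_le₀ (by linarith [n.cast_nonneg (α := ℝ)])
    calc _ ≤ 1 * C := mul_le_mul this (hbC _) (norm_nonneg _) zero_le_one
      _ = C := one_mul _
  · intro x
    filter_upwards [eventually_ge_atTop ⌈‖x‖⌉₊] with n hn
    have h1 : ‖x‖ ≤ n := Nat.ceil_le.1 hn
    have h2 : ‖((n : ℝ) + 1)⁻¹ • x‖ < 1 := by
      rw [norm_smul, Real.norm_of_nonneg (by positivity), inv_mul_lt_iff₀ (by positivity)]
      linarith
    exact ⟨hb1 _ h2.le, by rw [hg, hbg _ h2, smul_zero]⟩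


lemma sq_integral_le {g : ℝ → ℝ} (hg : Continuous g) :
    (∫ t in (0:ℝ)..1, g t) ^ 2 ≤ ∫ t in (0:ℝ)..1, g t ^ 2 := by
  set m := ∫ t in (0:ℝ)..1, g t with hm
  have h : 0 ≤ ∫ t in (0:ℝ)..1, (g t - m) ^ 2 :=
    intervalIntegral.integral_nonneg zero_le_one fun t _ => sq_nonneg _
  have i1 : IntervalIntegrable (fun t => g t ^ 2) volume 0 1 := (hg.pow 2).intervalIntegrable _ _
  have i2 : IntervalIntegrable (fun t => 2 * m * g t) volume 0 1 :=
    (continuous_const.mul hg).intervalIntegrable _ _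
  have h2 : ∫ t in (0:ℝ)..1, (g t - m) ^ 2 = (∫ t in (0:ℝ)..1, g t ^ 2) - 2 * m * m + m ^ 2 := by
    have : ∀ t, (g t - m) ^ 2 = g t ^ 2 - 2 * m * g t + m ^ 2 := fun t => by ring
    simp_rw [this]
    rw [intervalIntegral.integral_add (i1.sub i2) (by simp),
      intervalIntegral.integral_sub i1 i2, intervalIntegral.integral_const_mul]
    simp [← hm]
  nlinarith

lemma pt_bound {w : (EuclideanSpace ℝ (Fin N)) → ℝ} (hw : ContDiff ℝ 1 w) (x y : EuclideanSpace ℝ (Fin N)) :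
    (w x - w y) ^ 2 ≤ ‖x - y‖ ^ 2 * ∫ t in (0:ℝ)..1, ‖gradient w (y + t • (x - y))‖ ^ 2 := by
  have hγ : Continuous fun t : ℝ => y + t • (x - y) := by fun_prop
  have hd : ∀ t : ℝ, HasDerivAt (fun t : ℝ => w (y + t • (x - y)))
      (fderiv ℝ w (y + t • (x - y)) (x - y)) t := by
    intro t
    have h1 : HasDerivAt (fun t : ℝ => y + t • (x - y)) (x - y) t := by
      simpa using ((hasDerivAt_id t).smul_const (x - y)).const_add y
    exact ((hw.differentiable one_ne_zero _).hasFDerivAt).comp_hasDerivAt t h1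
  have hc : Continuous fun t : ℝ => fderiv ℝ w (y + t • (x - y)) (x - y) :=
    ((hw.continuous_fderiv one_ne_zero).comp hγ).clm_apply continuous_const
  have h := intervalIntegral.integral_eq_sub_of_hasDerivAt (a := 0) (b := 1)
    (fun t _ => hd t) (hc.intervalIntegrable _ _)
  simp only [one_smul, zero_smul, add_zero, add_sub_cancel] at h
  rw [← h, ← intervalIntegral.integral_const_mul]
  refine (sq_integral_le hc).trans ?_
  have hc2 : Continuous fun t : ℝ => ‖x - y‖ ^ 2 * ‖gradient w (y + t • (x - y))‖ ^ 2 :=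
    continuous_const.mul (((cont_grad hw).comp hγ).norm.pow 2)
  refine intervalIntegral.integral_mono_on zero_le_one ((hc.pow 2).intervalIntegrable _ _)
    (hc2.intervalIntegrable _ _) ?_
  intro t _
  rw [← inner_gradient_left, ← sq_abs, ← mul_pow]
  refine pow_le_pow_left₀ (abs_nonneg _) ?_ 2
  rw [mul_comm]
  exact abs_real_inner_le_norm _ _

lemma lint_scale {G : (EuclideanSpace ℝ (Fin N)) → ℝ≥0∞} (hG : Measurable G) (z : EuclideanSpace ℝ (Fin N)) {t : ℝ} (ht : 1 / 2 ≤ t) :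
    ∫⁻ x, G (z + t • x) ≤ 2 ^ N * ∫⁻ x, G x := by
  have ht0 : t ≠ 0 := by linarith
  have h1 : ∫⁻ x, G (z + t • x) = ∫⁻ x, G (z + x) ∂(Measure.map (t • ·) (volume : Measure (EuclideanSpace ℝ (Fin N)))) :=
    (lintegral_map (f := fun x => G (z + x)) (hG.comp (measurable_const_add z))
      (measurable_const_smul t)).symm
  rw [h1, Measure.map_addHaar_smul _ ht0, lintegral_smul_measure, lintegral_add_left_eq_self]
  simp only [finrank_euclideanSpace, Fintype.card_fin, smul_eq_mul]
  gcongr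
  have : |(t ^ N)⁻¹| ≤ 2 ^ N := by
    rw [abs_of_nonneg (by positivity), ← inv_pow]
    refine pow_le_pow_left₀ (by positivity) ?_ N
    rw [inv_le_comm₀ (by linarith) (by norm_num)]
    linarith
  calc ENNReal.ofReal |(t ^ N)⁻¹| ≤ ENNReal.ofReal (2 ^ N) := ENNReal.ofReal_le_ofReal this
    _ = 2 ^ N := by rw [ENNReal.ofReal_pow (by norm_num)]; simp

lemma double_bound {G : (EuclideanSpace ℝ (Fin N)) → ℝ≥0∞} (hG : Measurable G) (B : Set (EuclideanSpace ℝ (Fin N))) (t : ℝ) :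
    ∫⁻ y in B, ∫⁻ x in B, G (y + t • (x - y)) ≤ 2 ^ N * volume B * ∫⁻ x, G x := by
  have key : ∀ s : ℝ, 1 / 2 ≤ s → ∀ F : (EuclideanSpace ℝ (Fin N)) → (EuclideanSpace ℝ (Fin N)) → ℝ≥0∞,
      (∀ x y, F y x = G ((1 - s) • y + s • x)) →
      ∫⁻ y in B, ∫⁻ x in B, F y x ≤ 2 ^ N * volume B * ∫⁻ x, G x := by
    intro s hs F hF
    calc ∫⁻ y in B, ∫⁻ x in B, F y x ≤ ∫⁻ y in B, 2 ^ N * ∫⁻ x, G x := by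
          refine lintegral_mono fun y => ?_
          refine (setLIntegral_le_lintegral _ _).trans ?_
          simp_rw [hF]
          exact lint_scale hG _ hs
      _ = _ := by rw [setLIntegral_const]; ring
  rcases le_total (1/2) t with h | h
  · refine key t h _ fun x y => ?_
    congr 1; module
  · rw [lintegral_lintegral_swap]
    · refine key (1 - t) (by linarith) _ fun x y => ?_
      congr 1; module
    · have : Measurable fun p : (EuclideanSpace ℝ (Fin N)) × (EuclideanSpace ℝ (Fin N)) => G (p.1 + t • (p.2 - p.1)) := by
        apply hG.comp; fun_prop
      exact this.aemeasurable

lemma poincare {w : (EuclideanSpace ℝ (Fin N)) → ℝ} (hw : ContDiff ℝ 1 w) (r : ℝ) (hr : 0 < r) :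
    ∃ a : ℝ, ∫ x in Metric.ball (0 : EuclideanSpace ℝ (Fin N)) r, (w x - a) ^ 2
      ≤ (4 * r ^ 2 * 2 ^ N) * ∫ x in Metric.ball (0 : EuclideanSpace ℝ (Fin N)) r, ‖gradient w x‖ ^ 2 := by
  set B := Metric.ball (0 : EuclideanSpace ℝ (Fin N)) r with hB
  have hBm : MeasurableSet B := Metric.isOpen_ball.measurableSet
  have hgc := cont_grad hw
  set G : (EuclideanSpace ℝ (Fin N)) → ℝ≥0∞ := B.indicator fun x => ENNReal.ofReal (‖gradient w x‖ ^ 2) with hGdef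
  have hG : Measurable G := by
    refine Measurable.indicator ?_ hBm
    exact ((hgc.norm.pow 2).measurable).ennreal_ofReal
  have hpt : ∀ x ∈ B, ∀ y ∈ B, ENNReal.ofReal ((w x - w y) ^ 2)
      ≤ ENNReal.ofReal (4 * r ^ 2) * ∫⁻ t in Set.Ioc (0:ℝ) 1, G (y + t • (x - y)) := by
    intro x hx y hy
    have hγ : Continuous fun t : ℝ => y + t • (x - y) := by fun_prop
    have hn : ‖x - y‖ ≤ 2 * r := by
      have h1 : ‖x‖ < r := by simpa [hB] using hx
      have h2 : ‖y‖ < r := by simpa [hB] using hy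
      linarith [norm_sub_le x y]
    have h0 : 0 ≤ ∫ t in (0:ℝ)..1, ‖gradient w (y + t • (x - y))‖ ^ 2 :=
      intervalIntegral.integral_nonneg zero_le_one fun t _ => sq_nonneg _
    have h1 : (w x - w y) ^ 2 ≤ (4 * r ^ 2) *
        ∫ t in (0:ℝ)..1, ‖gradient w (y + t • (x - y))‖ ^ 2 := by
      refine (pt_bound hw x y).trans (mul_le_mul_of_nonneg_right ?_ h0)
      nlinarith [norm_nonneg (x - y)]
    refine (ENNReal.ofReal_le_ofReal h1).trans ?_
    rw [ENNReal.ofReal_mul (by positivity)]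
    gcongr
    rw [intervalIntegral.integral_of_le zero_le_one,
      ofReal_integral_eq_lintegral_ofReal]
    · refine setLIntegral_mono' measurableSet_Ioc fun t ht => ?_
      have : y + t • (x - y) ∈ B := by
        have := (convex_ball (0 : EuclideanSpace ℝ (Fin N)) r).add_smul_sub_mem hy hx ⟨ht.1.le, ht.2⟩
        exact this
      simp [hGdef, this]
    · exact ((hgc.comp hγ).norm.pow 2).integrableOn_Ioc
    · exact ae_of_all _ fun t => sq_nonneg _
  have hmeas : Measurable fun p : ((EuclideanSpace ℝ (Fin N)) × (EuclideanSpace ℝ (Fin N))) × ℝ => G (p.1.1 + p.2 • (p.1.2 - p.1.1)) := by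
    apply hG.comp; fun_prop
  have htot : ∫⁻ y in B, ∫⁻ x in B, ENNReal.ofReal ((w x - w y) ^ 2)
      ≤ ENNReal.ofReal (4 * r ^ 2) * (2 ^ N * volume B * ∫⁻ x, G x) := by
    calc ∫⁻ y in B, ∫⁻ x in B, ENNReal.ofReal ((w x - w y) ^ 2)
        ≤ ∫⁻ y in B, ∫⁻ x in B, ENNReal.ofReal (4 * r ^ 2) *
            ∫⁻ t in Set.Ioc (0:ℝ) 1, G (y + t • (x - y)) :=
          setLIntegral_mono' hBm fun y hy => setLIntegral_mono' hBm fun x hx => hpt x hx y hy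
      _ = ENNReal.ofReal (4 * r ^ 2) * ∫⁻ y in B, ∫⁻ x in B,
            ∫⁻ t in Set.Ioc (0:ℝ) 1, G (y + t • (x - y)) := by
          rw [← lintegral_const_mul' _ _ ofReal_ne_top]
          refine lintegral_congr fun y => ?_
          rw [← lintegral_const_mul' _ _ ofReal_ne_top]
      _ = ENNReal.ofReal (4 * r ^ 2) * ∫⁻ t in Set.Ioc (0:ℝ) 1, ∫⁻ y in B, ∫⁻ x in B,
            G (y + t • (x - y)) := by
          congr 1
          have e1 : ∀ y, ∫⁻ x in B, ∫⁻ t in Set.Ioc (0:ℝ) 1, G (y + t • (x - y))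
              = ∫⁻ t in Set.Ioc (0:ℝ) 1, ∫⁻ x in B, G (y + t • (x - y)) := by
            intro y
            rw [lintegral_lintegral_swap]
            refine Measurable.aemeasurable ?_
            apply hG.comp; fun_prop
          simp_rw [e1]
          rw [lintegral_lintegral_swap]
          refine Measurable.aemeasurable ?_
          refine Measurable.lintegral_prod_right' (f := fun p : ((EuclideanSpace ℝ (Fin N)) × ℝ) × (EuclideanSpace ℝ (Fin N)) =>
              G (p.1.1 + p.1.2 • (p.2 - p.1.1))) ?_
          apply hG.comp; fun_prop
      _ ≤ ENNReal.ofReal (4 * r ^ 2) * ∫⁻ t in Set.Ioc (0:ℝ) 1,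
            (2 ^ N * volume B * ∫⁻ x, G x) := by
          refine mul_le_mul_right ?_ _
          exact lintegral_mono fun t => double_bound hG B t
      _ = _ := by simp
  have hB0 : volume B ≠ 0 := (Metric.measure_ball_pos _ _ hr).ne'
  have hBt : volume B ≠ ∞ := measure_ball_lt_top.ne
  have hwc := hw.continuous
  obtain ⟨y, hy, hle⟩ := exists_le_setLAverage (μ := volume) (s := B)
    (f := fun y => ∫⁻ x in B, ENNReal.ofReal ((w x - w y) ^ 2)) hB0 hBt (by
      refine Measurable.aemeasurable ?_
      refine Measurable.lintegral_prod_right' (f := fun p : (EuclideanSpace ℝ (Fin N)) × (EuclideanSpace ℝ (Fin N)) =>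
              ENNReal.ofReal ((w p.2 - w p.1) ^ 2)) ?_
      fun_prop)
  refine ⟨w y, ?_⟩
  rw [setLAverage_eq] at hle
  have hfin : ∫⁻ x in B, ENNReal.ofReal ((w x - w y) ^ 2)
      ≤ ENNReal.ofReal (4 * r ^ 2 * 2 ^ N) * ∫⁻ x in B, ENNReal.ofReal (‖gradient w x‖ ^ 2) := by
    refine hle.trans ?_
    rw [ENNReal.div_le_iff hB0 hBt]
    refine htot.trans (le_of_eq ?_)
    rw [hGdef, lintegral_indicator hBm, ENNReal.ofReal_mul (by positivity : 0 ≤ 4 * r ^ 2),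
      show ENNReal.ofReal (2 ^ N) = 2 ^ N by rw [ENNReal.ofReal_pow (by norm_num)]; simp]
    ring
  have hint : ∀ f : (EuclideanSpace ℝ (Fin N)) → ℝ, Continuous f → IntegrableOn f B := fun f hf =>
    (hf.continuousOn.integrableOn_compact (isCompact_closedBall (0 : EuclideanSpace ℝ (Fin N)) r)).mono_set
      Metric.ball_subset_closedBall
  have hi1 := hint (fun x => (w x - w y) ^ 2) (by fun_prop)
  have hi2 := hint (fun x => ‖gradient w x‖ ^ 2) (hgc.norm.pow 2)
  rw [← ofReal_integral_eq_lintegral_ofReal hi1 (ae_of_all _ fun x => sq_nonneg _),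
    ← ofReal_integral_eq_lintegral_ofReal hi2 (ae_of_all _ fun x => sq_nonneg _),
    ← ENNReal.ofReal_mul (by positivity)] at hfin
  refine (ENNReal.ofReal_le_ofReal_iff ?_).1 hfin
  exact mul_nonneg (by positivity) (integral_nonneg fun x => sq_nonneg _)


lemma nsq_add_le {F : Type*} [SeminormedAddCommGroup F] (a b : F) :
    ‖a + b‖ ^ 2 ≤ 2 * ‖a‖ ^ 2 + 2 * ‖b‖ ^ 2 := by
  nlinarith [norm_add_le a b, norm_nonneg (a + b), norm_nonneg a, norm_nonneg b,
    sq_nonneg (‖a‖ - ‖b‖)]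

/-- the ground state (Jacobi) identity for compactly supported functions -/
lemma jacobi {V φ h : (EuclideanSpace ℝ (Fin N)) → ℝ} (hφ : ContDiff ℝ 2 φ)
    (heq : ∀ x, -(lap φ x) + V x * φ x = 0) (hh : ContDiff ℝ 1 h) (hc : HasCompactSupport h) :
    ∫ x, V x * (φ x * h x) ^ 2
      = ∫ x, (φ x ^ 2 * ‖gradient h x‖ ^ 2 - ‖gradient (fun y => φ y * h y) x‖ ^ 2) := by
  have hφ1 : ContDiff ℝ 1 φ := hφ.of_le (by norm_num)
  have hf : ContDiff ℝ 1 (fun y => φ y * h y) := hφ1.mul hh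
  have hψ : ContDiff ℝ 1 (fun y => (φ y * h y) * h y) := hf.mul hh
  have := ibp hφ hψ hc.mul_left
  have e1 : ∀ x, V x * (φ x * h x) ^ 2 = ((φ x * h x) * h x) * lap φ x := by
    intro x
    have : lap φ x = V x * φ x := by linarith [heq x]
    rw [this]; ring
  simp_rw [e1]
  rw [this, ← integral_neg]
  congr 1
  ext x
  have dφ := hφ1.differentiable one_ne_zero x
  have dh := hh.differentiable one_ne_zero x
  rw [grad_mul (f := fun y => φ y * h y) (dφ.mul dh) dh, grad_mul dφ dh, ← real_inner_self_eq_norm_sq,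
    ← real_inner_self_eq_norm_sq]
  simp only [inner_add_left, inner_add_right, inner_smul_left, inner_smul_right, RCLike.conj_to_real,
    smul_add]
  rw [real_inner_comm (gradient φ x) (gradient h x)]
  ring

lemma int_bdd_mul {V g : (EuclideanSpace ℝ (Fin N)) → ℝ} (hVm : Measurable V) {M : ℝ} (hM : ∀ x, |V x| ≤ M)
    (hg : Integrable g) : Integrable (fun x => V x * g x) :=
  hg.bdd_mul hVm.aestronglyMeasurable (ae_of_all _ hM)

lemma hardy_cpt {V φ h : (EuclideanSpace ℝ (Fin N)) → ℝ} (hφ : ContDiff ℝ 2 φ)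
    (heq : ∀ x, -(lap φ x) + V x * φ x = 0) (hh : ContDiff ℝ 1 h) (hc : HasCompactSupport h) :
    ∫ x, V x * (φ x * h x) ^ 2 ≤ ∫ x, φ x ^ 2 * ‖gradient h x‖ ^ 2 := by
  have hφ1 : ContDiff ℝ 1 φ := hφ.of_le (by norm_num)
  have hf : ContDiff ℝ 1 (fun y => φ y * h y) := hφ1.mul hh
  have s1 : HasCompactSupport (fun x => ‖gradient h x‖ ^ 2) :=
    (cs_grad hc).comp_left (g := fun z => ‖z‖ ^ 2) (by simp)
  have hi1 : Integrable (fun x => φ x ^ 2 * ‖gradient h x‖ ^ 2) :=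
    ((hφ.continuous.pow 2).mul ((cont_grad hh).norm.pow 2)).integrable_of_hasCompactSupport
      s1.mul_left
  have s2 : HasCompactSupport (fun x => ‖gradient (fun y => φ y * h y) x‖ ^ 2) :=
    (cs_grad hc.mul_left).comp_left (g := fun z => ‖z‖ ^ 2) (by simp)
  have hi2 : Integrable (fun x => ‖gradient (fun y => φ y * h y) x‖ ^ 2) :=
    ((cont_grad hf).norm.pow 2).integrable_of_hasCompactSupport s2
  rw [jacobi hφ heq hh hc]
  refine integral_mono (hi1.sub hi2) hi1 fun x => ?_
  simp only [Pi.sub_apply]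
  nlinarith [sq_nonneg ‖gradient (fun y => φ y * h y) x‖]

lemma hardy {V φ h : (EuclideanSpace ℝ (Fin N)) → ℝ} (hVm : Measurable V) {M : ℝ} (hM : ∀ x, |V x| ≤ M)
    (hφ : ContDiff ℝ 2 φ)
    (heq : ∀ x, -(lap φ x) + V x * φ x = 0) (hh : ContDiff ℝ 1 h)
    (h1 : Integrable fun x => (φ x * h x) ^ 2)
    (h2 : Integrable fun x => φ x ^ 2 * ‖gradient h x‖ ^ 2) :
    ∫ x, V x * (φ x * h x) ^ 2 ≤ ∫ x, φ x ^ 2 * ‖gradient h x‖ ^ 2 := by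
  obtain ⟨χ, C, hC0, hχ, hχc, hχ01, hχC, hχl⟩ := exists_cutoff (N := N)
  have hcφ := hφ.continuous
  have hch := hh.continuous
  have hdχ : ∀ n x, DifferentiableAt ℝ (χ n) x := fun n x => (hχ n).differentiable one_ne_zero x
  have hdh : ∀ x, DifferentiableAt ℝ h x := fun x => hh.differentiable one_ne_zero x
  have T1 : Tendsto (fun n => ∫ x, V x * (φ x * (χ n x * h x)) ^ 2) atTop
      (nhds (∫ x, V x * (φ x * h x) ^ 2)) := by
    refine tendsto_integral_of_dominated_convergence (fun x => M * (φ x * h x) ^ 2) ?_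
      (h1.const_mul M) ?_ ?_
    · intro n
      have hcc : Continuous fun x => (φ x * (χ n x * h x)) ^ 2 := by
        have := (hχ n).continuous
        fun_prop
      exact hVm.aestronglyMeasurable.mul hcc.aestronglyMeasurable
    · intro n
      refine ae_of_all _ fun x => ?_
      rw [Real.norm_eq_abs, abs_mul, abs_of_nonneg (sq_nonneg (φ x * (χ n x * h x)))]
      refine mul_le_mul (hM x) ?_ (sq_nonneg _) ((abs_nonneg _).trans (hM x))
      have : (χ n x) ^ 2 ≤ 1 := by nlinarith [hχ01 n x]
      nlinarith [mul_le_mul_of_nonneg_right this (sq_nonneg (φ x * h x))]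
    · refine ae_of_all _ fun x => ?_
      refine tendsto_const_nhds.congr' ?_
      filter_upwards [hχl x] with n hn
      rw [hn.1, one_mul]
  have T2 : Tendsto (fun n => ∫ x, φ x ^ 2 * ‖gradient (fun y => χ n y * h y) x‖ ^ 2) atTop
      (nhds (∫ x, φ x ^ 2 * ‖gradient h x‖ ^ 2)) := by
    refine tendsto_integral_of_dominated_convergence
      (fun x => 2 * (φ x ^ 2 * ‖gradient h x‖ ^ 2) + (2 * C ^ 2) * (φ x * h x) ^ 2) ?_
      ((h2.const_mul 2).add (h1.const_mul _)) ?_ ?_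
    · intro n
      exact ((hcφ.pow 2).mul ((cont_grad ((hχ n).mul hh)).norm.pow 2)).aestronglyMeasurable
    · intro n
      refine ae_of_all _ fun x => ?_
      rw [grad_mul (hdχ n x) (hdh x), Real.norm_of_nonneg (by positivity)]
      have e1 := nsq_add_le (χ n x • gradient h x) (h x • gradient (χ n) x)
      rw [norm_smul, norm_smul, mul_pow, mul_pow, Real.norm_eq_abs, Real.norm_eq_abs, sq_abs,
        sq_abs] at e1
      have e2 : (χ n x) ^ 2 ≤ 1 := by nlinarith [hχ01 n x]
      have e3 : ‖gradient (χ n) x‖ ^ 2 ≤ C ^ 2 := pow_le_pow_left₀ (norm_nonneg _) (hχC n x) 2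
      calc _ ≤ φ x ^ 2 * (2 * (1 * ‖gradient h x‖ ^ 2) + 2 * (h x ^ 2 * C ^ 2)) := by
            refine mul_le_mul_of_nonneg_left (e1.trans ?_) (sq_nonneg _)
            gcongr
        _ = _ := by ring
    · refine ae_of_all _ fun x => ?_
      refine tendsto_const_nhds.congr' ?_
      filter_upwards [hχl x] with n hn
      rw [grad_mul (hdχ n x) (hdh x), hn.1, hn.2]; simp
  exact le_of_tendsto_of_tendsto' T1 T2 fun n =>
    hardy_cpt hφ heq ((hχ n).mul hh) (hχc n).mul_right

lemma gap_cpt {V φ : (EuclideanSpace ℝ (Fin N)) → ℝ} (hVm : Measurable V) {M : ℝ} (hM : ∀ x, |V x| ≤ M)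
    {R c : ℝ} (hR : 0 < R) (hc : 0 < c) (hV : ∀ x, R ≤ ‖x‖ → c ≤ V x)
    (hφ : ContDiff ℝ 2 φ) (hpos : ∀ x, 0 < φ x) (hφi : Integrable fun x => φ x ^ 2)
    (heq : ∀ x, -(lap φ x) + V x * φ x = 0) :
    ∃ C : ℝ, 0 < C ∧ ∀ w : (EuclideanSpace ℝ (Fin N)) → ℝ, ContDiff ℝ 1 w → HasCompactSupport w →
      ∃ a : ℝ, ∫ x, (φ x * (w x - a)) ^ 2 ≤ C * ∫ x, φ x ^ 2 * ‖gradient w x‖ ^ 2 := by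
  obtain ⟨b, K, hK0, hb, hbc, hb01, hbK, hb1, hb0, -, hbg0⟩ := bump_facts (N := N) R hR
  have hcφ := hφ.continuous
  obtain ⟨xm, -, hxm⟩ := (isCompact_closedBall (0 : EuclideanSpace ℝ (Fin N)) (3 * R)).exists_isMinOn
    ⟨0, by simp; positivity⟩ hcφ.continuousOn
  obtain ⟨xM, -, hxM⟩ := (isCompact_closedBall (0 : EuclideanSpace ℝ (Fin N)) (3 * R)).exists_isMaxOn
    ⟨0, by simp; positivity⟩ hcφ.continuousOn
  set m := φ xm
  set m' := φ xM
  have hm : 0 < m := hpos _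
  have hm' : 0 < m' := hpos _
  set B := Metric.ball (0 : EuclideanSpace ℝ (Fin N)) (3 * R) with hBdef
  have hBm : MeasurableSet B := Metric.isOpen_ball.measurableSet
  have hBl : ∀ x ∈ B, m ≤ φ x := fun x hx => hxm (Metric.ball_subset_closedBall hx)
  have hBu : ∀ x ∈ B, φ x ≤ m' := fun x hx => hxM (Metric.ball_subset_closedBall hx)
  set C1 := 4 * (3 * R) ^ 2 * 2 ^ N with hC1
  set C2 := m' ^ 2 * C1 / m ^ 2 with hC2
  have hC1p : 0 < C1 := by positivity
  have hC2p : 0 < C2 := by positivity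
  refine ⟨C2 + (2 + 2 * K ^ 2 * C2) / c, by positivity, fun w hw hwc => ?_⟩
  obtain ⟨a, ha⟩ := poincare hw (3 * R) (by positivity)
  refine ⟨a, ?_⟩
  have hcw := hw.continuous
  have hgw := cont_grad hw
  set D := ∫ x, φ x ^ 2 * ‖gradient w x‖ ^ 2 with hD
  have s1 : HasCompactSupport (fun x => ‖gradient w x‖ ^ 2) :=
    (cs_grad hwc).comp_left (g := fun z => ‖z‖ ^ 2) (by simp)
  have iD : Integrable (fun x => φ x ^ 2 * ‖gradient w x‖ ^ 2) :=
    ((hcφ.pow 2).mul (hgw.norm.pow 2)).integrable_of_hasCompactSupport s1.mul_left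
  have hint : ∀ f : (EuclideanSpace ℝ (Fin N)) → ℝ, Continuous f → IntegrableOn f B := fun f hf =>
    (hf.continuousOn.integrableOn_compact (isCompact_closedBall (0 : EuclideanSpace ℝ (Fin N)) (3 * R))).mono_set
      Metric.ball_subset_closedBall
  have ifφ : Integrable (fun x => (φ x * w x) ^ 2) := by
    have hcs : HasCompactSupport (fun x => φ x * w x) := hwc.mul_left
    exact (by fun_prop : Continuous (fun x => (φ x * w x) ^ 2)).integrable_of_hasCompactSupport
      (hcs.comp_left (g := fun z => z ^ 2) (by simp))
  have ifa : Integrable (fun x => (φ x * (w x - a)) ^ 2) := by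
    refine Integrable.mono' ((ifφ.const_mul 2).add (hφi.const_mul (2 * a ^ 2)))
      (by fun_prop : Continuous (fun x => (φ x * (w x - a)) ^ 2)).aestronglyMeasurable ?_
    refine ae_of_all _ fun x => ?_
    rw [Real.norm_of_nonneg (sq_nonneg _)]
    simp only [Pi.add_apply]
    nlinarith [sq_nonneg (φ x * w x + a * φ x)]
  -- the inner part
  have hin : ∫ x in B, (φ x * (w x - a)) ^ 2 ≤ C2 * D := by
    have q1 : ∫ x in B, (φ x * (w x - a)) ^ 2 ≤ m' ^ 2 * ∫ x in B, (w x - a) ^ 2 := by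
      rw [← integral_const_mul]
      refine setIntegral_mono_on (hint _ (by fun_prop)) (hint _ (by fun_prop)) hBm fun x hx => ?_
      rw [mul_pow]
      exact mul_le_mul_of_nonneg_right
        (pow_le_pow_left₀ (hpos x).le (hBu x hx) 2) (sq_nonneg _)
    have q2 : m ^ 2 * ∫ x in B, ‖gradient w x‖ ^ 2 ≤ D := by
      rw [← integral_const_mul]
      refine le_trans (b := ∫ x in B, φ x ^ 2 * ‖gradient w x‖ ^ 2) ?_ ?_
      · refine setIntegral_mono_on (hint _ (by fun_prop)) (hint _ (by fun_prop)) hBm fun x hx => ?_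
        exact mul_le_mul_of_nonneg_right
          (pow_le_pow_left₀ hm.le (hBl x hx) 2) (sq_nonneg _)
      · exact setIntegral_le_integral iD (ae_of_all _ fun x => by positivity)
    have q3 : ∫ x in B, ‖gradient w x‖ ^ 2 ≤ D / m ^ 2 := by
      rw [le_div_iff₀ (by positivity)]; linarith
    calc _ ≤ m' ^ 2 * (C1 * (D / m ^ 2)) := by
          refine q1.trans (mul_le_mul_of_nonneg_left (ha.trans ?_) (sq_nonneg _))
          exact mul_le_mul_of_nonneg_left q3 hC1p.le
      _ = C2 * D := by rw [hC2]; ring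
  -- the outer part
  set h : (EuclideanSpace ℝ (Fin N)) → ℝ := fun x => (1 - b x) * (w x - a) with hh
  have hη : ContDiff ℝ 1 (fun x => 1 - b x) := contDiff_const.sub hb
  have hwa : ContDiff ℝ 1 (fun x => w x - a) := hw.sub contDiff_const
  have hhc : ContDiff ℝ 1 h := hη.mul hwa
  have hcb := hb.continuous
  have hgh : ∀ x, gradient h x = (1 - b x) • gradient w x - (w x - a) • gradient b x := by
    intro x
    have db := hb.differentiable one_ne_zero x
    have dw := hw.differentiable one_ne_zero x
    rw [hh, grad_mul (hη.differentiable one_ne_zero x) (hwa.differentiable one_ne_zero x),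
      grad_sub dw (differentiableAt_const a), grad_sub (differentiableAt_const 1) db]
    simp [sub_eq_add_neg]
  have ih1 : Integrable (fun x => (φ x * h x) ^ 2) := by
    refine Integrable.mono' ifa
      (by fun_prop : Continuous (fun x => (φ x * h x) ^ 2)).aestronglyMeasurable ?_
    refine ae_of_all _ fun x => ?_
    rw [Real.norm_of_nonneg (sq_nonneg _)]
    have : (1 - b x) ^ 2 ≤ 1 := by nlinarith [hb01 x]
    have := mul_le_mul_of_nonneg_right this (sq_nonneg (φ x * (w x - a)))
    simp only [hh]
    linarith
  have iind : Integrable (B.indicator fun x => (φ x * (w x - a)) ^ 2) := ifa.indicator hBm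
  have ptg : ∀ x, φ x ^ 2 * ‖gradient h x‖ ^ 2 ≤ 2 * (φ x ^ 2 * ‖gradient w x‖ ^ 2)
      + 2 * K ^ 2 * B.indicator (fun x => (φ x * (w x - a)) ^ 2) x := by
    intro x
    rw [hgh, sub_eq_add_neg]
    have e1 := nsq_add_le ((1 - b x) • gradient w x) (-((w x - a) • gradient b x))
    rw [norm_neg, norm_smul, norm_smul, mul_pow, mul_pow, Real.norm_eq_abs, Real.norm_eq_abs, sq_abs,
        sq_abs] at e1
    have e2 : (1 - b x) ^ 2 ≤ 1 := by nlinarith [hb01 x]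
    by_cases hx : x ∈ B
    · rw [Set.indicator_of_mem hx]
      have e3 : ‖gradient b x‖ ^ 2 ≤ K ^ 2 := pow_le_pow_left₀ (norm_nonneg _) (hbK x) 2
      calc _ ≤ φ x ^ 2 * (2 * (1 * ‖gradient w x‖ ^ 2) + 2 * ((w x - a) ^ 2 * K ^ 2)) := by
            refine mul_le_mul_of_nonneg_left (e1.trans ?_) (sq_nonneg _)
            gcongr
        _ = _ := by ring
    · rw [Set.indicator_of_notMem hx]
      have : gradient b x = 0 := hbg0 x (by simpa [hBdef] using hx)
      rw [this] at e1 ⊢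
      calc _ ≤ φ x ^ 2 * (2 * (1 * ‖gradient w x‖ ^ 2) + 0) := by
            refine mul_le_mul_of_nonneg_left (e1.trans ?_) (sq_nonneg _)
            simp only [norm_zero]
            have := mul_le_mul_of_nonneg_right e2 (sq_nonneg ‖gradient w x‖)
            linarith
        _ = _ := by ring
  have ibd : Integrable (fun x => 2 * (φ x ^ 2 * ‖gradient w x‖ ^ 2)
      + 2 * K ^ 2 * B.indicator (fun x => (φ x * (w x - a)) ^ 2) x) :=
    (iD.const_mul 2).add (iind.const_mul (2 * K ^ 2))
  have ih2 : Integrable (fun x => φ x ^ 2 * ‖gradient h x‖ ^ 2) := by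
    refine Integrable.mono' ibd
      ((hcφ.pow 2).mul ((cont_grad hhc).norm.pow 2)).aestronglyMeasurable ?_
    refine ae_of_all _ fun x => ?_
    rw [Real.norm_of_nonneg (by positivity)]
    exact ptg x
  have H := hardy hVm hM hφ heq hhc ih1 ih2
  have H2 : ∫ x, φ x ^ 2 * ‖gradient h x‖ ^ 2 ≤ 2 * D + 2 * K ^ 2 * (C2 * D) := by
    refine (integral_mono ih2 ibd ptg).trans ?_
    rw [integral_add (iD.const_mul 2) (iind.const_mul (2 * K ^ 2)), integral_const_mul,
      integral_const_mul, integral_indicator hBm]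
    have := mul_le_mul_of_nonneg_left hin (by positivity : 0 ≤ 2 * K ^ 2)
    linarith
  have H3 : c * ∫ x, (φ x * h x) ^ 2 ≤ ∫ x, V x * (φ x * h x) ^ 2 := by
    rw [← integral_const_mul]
    refine integral_mono (ih1.const_mul c) (int_bdd_mul hVm hM ih1) fun x => ?_
    simp only
    rcases le_total R ‖x‖ with hx | hx
    · exact mul_le_mul_of_nonneg_right (hV x hx) (sq_nonneg _)
    · simp [hh, hb1 x hx]
  have H4 : ∫ x, (φ x * h x) ^ 2 ≤ (2 + 2 * K ^ 2 * C2) / c * D := by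
    rw [div_mul_eq_mul_div, le_div_iff₀ hc]
    linarith
  have H5 : ∫ x, (φ x * (w x - a)) ^ 2
      ≤ ∫ x, (B.indicator (fun x => (φ x * (w x - a)) ^ 2) x + (φ x * h x) ^ 2) := by
    refine integral_mono ifa (iind.add ih1) fun x => ?_
    simp only
    by_cases hx : x ∈ B
    · rw [Set.indicator_of_mem hx]
      nlinarith [sq_nonneg (φ x * h x)]
    · rw [Set.indicator_of_notMem hx]
      have : b x = 0 := hb0 x (by simpa [hBdef] using hx)
      simp [hh, this]
  rw [integral_add iind ih1, integral_indicator hBm] at H5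
  rw [add_mul]
  linarith


lemma gap_cpt2 {V φ : (EuclideanSpace ℝ (Fin N)) → ℝ} (hVm : Measurable V) {M : ℝ} (hM : ∀ x, |V x| ≤ M)
    {R c : ℝ} (hR : 0 < R) (hc : 0 < c) (hV : ∀ x, R ≤ ‖x‖ → c ≤ V x)
    (hφ : ContDiff ℝ 2 φ) (hpos : ∀ x, 0 < φ x) (hφi : Integrable fun x => φ x ^ 2)
    (heq : ∀ x, -(lap φ x) + V x * φ x = 0) :
    ∃ C : ℝ, 0 < C ∧ ∀ f : (EuclideanSpace ℝ (Fin N)) → ℝ, ContDiff ℝ 1 f → HasCompactSupport f →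
      0 ≤ ∫ x, (‖gradient f x‖ ^ 2 + V x * f x ^ 2) ∧
      (∫ x, φ x ^ 2) * (∫ x, f x ^ 2) ≤
        (∫ x, φ x ^ 2) * (C * ∫ x, (‖gradient f x‖ ^ 2 + V x * f x ^ 2))
          + (∫ x, f x * φ x) ^ 2 := by
  obtain ⟨C, hC, hgap⟩ := gap_cpt hVm hM hR hc hV hφ hpos hφi heq
  refine ⟨C, hC, fun f hf hfc => ?_⟩
  have hφ1 : ContDiff ℝ 1 φ := hφ.of_le (by norm_num)
  have hcφ := hφ.continuous
  have hcf := hf.continuous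
  obtain ⟨w, hwd, hwc, hφw⟩ : ∃ w : (EuclideanSpace ℝ (Fin N)) → ℝ, ContDiff ℝ 1 w ∧ HasCompactSupport w ∧
      ∀ x, φ x * w x = f x := by
    refine ⟨fun x => f x * (φ x)⁻¹, hf.mul (hφ1.inv fun x => (hpos x).ne'), hfc.mul_right, ?_⟩
    intro x
    have := (hpos x).ne'
    field_simp
  have hfun : (fun y => φ y * w y) = f := funext hφw
  have J := jacobi hφ heq hwd hwc
  rw [hfun] at J
  simp_rw [hφw] at J
  have s1 : HasCompactSupport (fun x => ‖gradient w x‖ ^ 2) :=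
    (cs_grad hwc).comp_left (g := fun z => ‖z‖ ^ 2) (by simp)
  have hi1 : Integrable (fun x => φ x ^ 2 * ‖gradient w x‖ ^ 2) :=
    ((hφ.continuous.pow 2).mul ((cont_grad hwd).norm.pow 2)).integrable_of_hasCompactSupport
      s1.mul_left
  have s2 : HasCompactSupport (fun x => ‖gradient f x‖ ^ 2) :=
    (cs_grad hfc).comp_left (g := fun z => ‖z‖ ^ 2) (by simp)
  have hi2 : Integrable (fun x => ‖gradient f x‖ ^ 2) :=
    ((cont_grad hf).norm.pow 2).integrable_of_hasCompactSupport s2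
  have s3 : HasCompactSupport (fun x => f x * f x) := hfc.mul_left
  have hi3 : Integrable (fun x => f x ^ 2) := by
    simp_rw [sq]
    exact (hcf.mul hcf).integrable_of_hasCompactSupport s3
  have hi4 : Integrable (fun x => f x * φ x) :=
    (hcf.mul hcφ).integrable_of_hasCompactSupport hfc.mul_right
  have hQ : ∫ x, (‖gradient f x‖ ^ 2 + V x * f x ^ 2) = ∫ x, φ x ^ 2 * ‖gradient w x‖ ^ 2 := by
    rw [integral_add hi2 (int_bdd_mul hVm hM hi3), J, integral_sub hi1 hi2]
    ring
  rw [hQ]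
  refine ⟨integral_nonneg fun x => by positivity, ?_⟩
  obtain ⟨a, ha⟩ := hgap w hwd hwc
  have e : ∫ x, (φ x * (w x - a)) ^ 2
      = (∫ x, f x ^ 2) - 2 * a * (∫ x, f x * φ x) + a ^ 2 * ∫ x, φ x ^ 2 := by
    have : ∀ x, (φ x * (w x - a)) ^ 2 = f x ^ 2 - 2 * a * (f x * φ x) + a ^ 2 * φ x ^ 2 := by
      intro x
      rw [mul_sub, hφw]; ring
    simp_rw [this]
    have i5 : Integrable (fun x => f x ^ 2 - 2 * a * (f x * φ x)) :=
      hi3.sub (hi4.const_mul (2 * a))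
    rw [integral_add i5 (hφi.const_mul _),
      integral_sub hi3 (hi4.const_mul _), integral_const_mul, integral_const_mul]
  rw [e] at ha
  have hΦ : 0 ≤ ∫ x, φ x ^ 2 := integral_nonneg fun x => sq_nonneg _
  have h1 := mul_le_mul_of_nonneg_left ha hΦ
  have h2 := sq_nonneg (a * (∫ x, φ x ^ 2) - ∫ x, f x * φ x)
  clear ha e hQ J
  generalize (∫ x, φ x ^ 2) = Φ at *
  generalize (∫ x, f x * φ x) = P at *
  generalize (∫ x, f x ^ 2) = A at *
  generalize (∫ x, φ x ^ 2 * ‖gradient w x‖ ^ 2) = D at *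
  linarith

lemma gap {V φ : (EuclideanSpace ℝ (Fin N)) → ℝ} (hVm : Measurable V) {M : ℝ} (hM : ∀ x, |V x| ≤ M)
    {R c : ℝ} (hR : 0 < R) (hc : 0 < c) (hV : ∀ x, R ≤ ‖x‖ → c ≤ V x)
    (hφ : ContDiff ℝ 2 φ) (hpos : ∀ x, 0 < φ x) (hφm : MemLp φ 2 volume)
    (heq : ∀ x, -(lap φ x) + V x * φ x = 0) :
    ∃ C : ℝ, 0 < C ∧ ∀ v : (EuclideanSpace ℝ (Fin N)) → ℝ, ContDiff ℝ 1 v → MemLp v 2 volume →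
      MemLp (fun x => gradient v x) 2 volume →
      0 ≤ ∫ x, (‖gradient v x‖ ^ 2 + V x * v x ^ 2) ∧
      (∫ x, φ x ^ 2) * (∫ x, v x ^ 2) ≤
        (∫ x, φ x ^ 2) * (C * ∫ x, (‖gradient v x‖ ^ 2 + V x * v x ^ 2))
          + (∫ x, v x * φ x) ^ 2 := by
  obtain ⟨C, hC, hgap⟩ := gap_cpt2 hVm hM hR hc hV hφ hpos hφm.integrable_sq heq
  refine ⟨C, hC, fun v hv hv2 hvg => ?_⟩
  obtain ⟨χ, K, hK0, hχ, hχc, hχ01, hχK, hχl⟩ := exists_cutoff (N := N)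
  have hcφ := hφ.continuous
  have hcv := hv.continuous
  have hdχ : ∀ n x, DifferentiableAt ℝ (χ n) x := fun n x => (hχ n).differentiable one_ne_zero x
  have hdv : ∀ x, DifferentiableAt ℝ v x := fun x => hv.differentiable one_ne_zero x
  have iv : Integrable (fun x => v x ^ 2) := hv2.integrable_sq
  have ig : Integrable (fun x => ‖gradient v x‖ ^ 2) :=
    (memLp_two_iff_integrable_sq_norm hvg.1).1 hvg
  have ivφ : Integrable (fun x => v x * φ x) := hv2.integrable_mul hφm
  have hM0 : 0 ≤ M := (abs_nonneg _).trans (hM 0)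
  have hχsq : ∀ n x, (χ n x) ^ 2 ≤ 1 := fun n x => by nlinarith [hχ01 n x]
  have hsq : ∀ n x, (χ n x * v x) ^ 2 ≤ v x ^ 2 := fun n x => by
    rw [mul_pow]
    exact mul_le_of_le_one_left (sq_nonneg _) (hχsq n x)
  have T1 : Tendsto (fun n => ∫ x, (χ n x * v x) ^ 2) atTop (nhds (∫ x, v x ^ 2)) := by
    refine tendsto_integral_of_dominated_convergence (fun x => v x ^ 2) ?_ iv ?_ ?_
    · intro n
      exact (((hχ n).continuous.mul hcv).pow 2).aestronglyMeasurable
    · intro n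
      refine ae_of_all _ fun x => ?_
      rw [Real.norm_of_nonneg (sq_nonneg _)]
      exact hsq n x
    · refine ae_of_all _ fun x => ?_
      refine tendsto_const_nhds.congr' ?_
      filter_upwards [hχl x] with n hn
      rw [hn.1, one_mul]
  have T2 : Tendsto (fun n => ∫ x, (χ n x * v x) * φ x) atTop (nhds (∫ x, v x * φ x)) := by
    refine tendsto_integral_of_dominated_convergence (fun x => |v x * φ x|) ?_ ivφ.abs ?_ ?_
    · intro n
      exact (((hχ n).continuous.mul hcv).mul hcφ).aestronglyMeasurable
    · intro n
      refine ae_of_all _ fun x => ?_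
      rw [mul_assoc, Real.norm_eq_abs, abs_mul, abs_of_nonneg (hχ01 n x).1]
      exact mul_le_of_le_one_left (abs_nonneg _) (hχ01 n x).2
    · refine ae_of_all _ fun x => ?_
      refine tendsto_const_nhds.congr' ?_
      filter_upwards [hχl x] with n hn
      rw [hn.1, one_mul]
  have T3 : Tendsto (fun n => ∫ x, (‖gradient (fun y => χ n y * v y) x‖ ^ 2
      + V x * (χ n x * v x) ^ 2)) atTop (nhds (∫ x, (‖gradient v x‖ ^ 2 + V x * v x ^ 2))) := by
    refine tendsto_integral_of_dominated_convergence
      (fun x => 2 * ‖gradient v x‖ ^ 2 + (2 * K ^ 2 + M) * v x ^ 2) ?_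
      ((ig.const_mul 2).add (iv.const_mul _)) ?_ ?_
    · intro n
      refine ((cont_grad ((hχ n).mul hv)).norm.pow 2).aestronglyMeasurable.add ?_
      exact hVm.aestronglyMeasurable.mul
        (((hχ n).continuous.mul hcv).pow 2).aestronglyMeasurable
    · intro n
      refine ae_of_all _ fun x => ?_
      rw [grad_mul (hdχ n x) (hdv x)]
      have e1 := nsq_add_le (χ n x • gradient v x) (v x • gradient (χ n) x)
      rw [norm_smul, norm_smul, mul_pow, mul_pow, Real.norm_eq_abs, Real.norm_eq_abs, sq_abs,
        sq_abs] at e1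
      have e3 : ‖gradient (χ n) x‖ ^ 2 ≤ K ^ 2 := pow_le_pow_left₀ (norm_nonneg _) (hχK n x) 2
      have e4 : |V x * (χ n x * v x) ^ 2| ≤ M * v x ^ 2 := by
        rw [abs_mul, abs_of_nonneg (sq_nonneg (χ n x * v x))]
        exact mul_le_mul (hM x) (hsq n x) (sq_nonneg _) hM0
      have e5 := mul_le_mul_of_nonneg_right (hχsq n x) (sq_nonneg ‖gradient v x‖)
      have e6 := mul_le_mul_of_nonneg_left e3 (sq_nonneg (v x))
      refine (norm_add_le _ _).trans ?_
      rw [Real.norm_of_nonneg (sq_nonneg _), Real.norm_eq_abs]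
      linarith
    · refine ae_of_all _ fun x => ?_
      refine tendsto_const_nhds.congr' ?_
      filter_upwards [hχl x] with n hn
      rw [grad_mul (hdχ n x) (hdv x), hn.1, hn.2]; simp
  have hall := fun n => hgap (fun x => χ n x * v x) ((hχ n).mul hv) (hχc n).mul_right
  exact ⟨ge_of_tendsto' T3 fun n => (hall n).1,
    le_of_tendsto_of_tendsto' (T1.const_mul _) (((T3.const_mul C).const_mul _).add (T2.pow 2))
      fun n => (hall n).2⟩

lemma green {v : (EuclideanSpace ℝ (Fin N)) → ℝ} (hv : ContDiff ℝ 2 v) (hv2 : MemLp v 2 volume)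
    (hvg : MemLp (fun x => gradient v x) 2 volume) (hvl : MemLp (fun x => lap v x) 2 volume) :
    ∫ x, v x * lap v x = - ∫ x, ‖gradient v x‖ ^ 2 := by
  obtain ⟨χ, K, hK0, hχ, hχc, hχ01, hχK, hχl⟩ := exists_cutoff (N := N)
  have hv1 : ContDiff ℝ 1 v := hv.of_le (by norm_num)
  have hcv := hv.continuous
  have hdχ : ∀ n x, DifferentiableAt ℝ (χ n) x := fun n x => (hχ n).differentiable one_ne_zero x
  have hdv : ∀ x, DifferentiableAt ℝ v x := fun x => hv1.differentiable one_ne_zero x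
  have iv : Integrable (fun x => v x ^ 2) := hv2.integrable_sq
  have ig : Integrable (fun x => ‖gradient v x‖ ^ 2) :=
    (memLp_two_iff_integrable_sq_norm hvg.1).1 hvg
  have il : Integrable (fun x => v x * lap v x) := hv2.integrable_mul hvl
  have T1 : Tendsto (fun n => ∫ x, (χ n x * v x) * lap v x) atTop
      (nhds (∫ x, v x * lap v x)) := by
    refine tendsto_integral_of_dominated_convergence (fun x => |v x * lap v x|) ?_ il.abs ?_ ?_
    · intro n
      exact (((hχ n).continuous.mul hcv).mul (cont_lap hv)).aestronglyMeasurable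
    · intro n
      refine ae_of_all _ fun x => ?_
      rw [mul_assoc, Real.norm_eq_abs, abs_mul, abs_of_nonneg (hχ01 n x).1]
      exact mul_le_of_le_one_left (abs_nonneg _) (hχ01 n x).2
    · refine ae_of_all _ fun x => ?_
      refine tendsto_const_nhds.congr' ?_
      filter_upwards [hχl x] with n hn
      rw [hn.1, one_mul]
  have T2 : Tendsto (fun n => ∫ x, inner ℝ (gradient (fun y => χ n y * v y) x) (gradient v x))
      atTop (nhds (∫ x, ‖gradient v x‖ ^ 2)) := by
    refine tendsto_integral_of_dominated_convergence
      (fun x => (1 + K ^ 2) * ‖gradient v x‖ ^ 2 + v x ^ 2) ?_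
      ((ig.const_mul _).add iv) ?_ ?_
    · intro n
      exact ((cont_grad ((hχ n).mul hv1)).inner (cont_grad hv1)).aestronglyMeasurable
    · intro n
      refine ae_of_all _ fun x => ?_
      rw [grad_mul (hdχ n x) (hdv x)]
      have e0 := abs_real_inner_le_norm (χ n x • gradient v x + v x • gradient (χ n) x)
        (gradient v x)
      have e1 : ‖χ n x • gradient v x + v x • gradient (χ n) x‖ ≤ ‖gradient v x‖ + |v x| * K := by
        refine (norm_add_le _ _).trans ?_
        rw [norm_smul, norm_smul, Real.norm_eq_abs, Real.norm_eq_abs, abs_of_nonneg (hχ01 n x).1]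
        exact add_le_add (mul_le_of_le_one_left (norm_nonneg _) (hχ01 n x).2)
          (mul_le_mul_of_nonneg_left (hχK n x) (abs_nonneg _))
      have e2 := mul_le_mul_of_nonneg_right e1 (norm_nonneg (gradient v x))
      rw [Real.norm_eq_abs]
      refine (e0.trans e2).trans ?_
      nlinarith [sq_nonneg (|v x| - K * ‖gradient v x‖), sq_abs (v x),
        sq_nonneg (K * ‖gradient v x‖), sq_nonneg (v x)]
    · refine ae_of_all _ fun x => ?_
      refine tendsto_const_nhds.congr' ?_
      filter_upwards [hχl x] with n hn
      rw [grad_mul (hdχ n x) (hdv x), hn.1, hn.2]; simp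
  refine tendsto_nhds_unique T1 (T2.neg.congr fun n => ?_)
  exact (ibp hv ((hχ n).mul hv1) (hχc n).mul_right).symm


lemma coer {V φ : (EuclideanSpace ℝ (Fin N)) → ℝ} (hVm : Measurable V) {M : ℝ} (hM : ∀ x, |V x| ≤ M)
    {R c : ℝ} (hR : 0 < R) (hc : 0 < c) (hV : ∀ x, R ≤ ‖x‖ → c ≤ V x)
    (hφ : ContDiff ℝ 2 φ) (hpos : ∀ x, 0 < φ x) (hφm : MemLp φ 2 volume)
    (heq : ∀ x, -(lap φ x) + V x * φ x = 0) :
    ∃ K1 K2 : ℝ, 0 < K1 ∧ 0 < K2 ∧ ∀ v : (EuclideanSpace ℝ (Fin N)) → ℝ, ContDiff ℝ 1 v → MemLp v 2 volume →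
      MemLp (fun x => gradient v x) 2 volume →
      0 ≤ ∫ x, (‖gradient v x‖ ^ 2 + V x * v x ^ 2) ∧
      (∫ x, (‖gradient v x‖ ^ 2 + V x * v x ^ 2)) ≤
        (1 + M) * ∫ x, (v x ^ 2 + ‖gradient v x‖ ^ 2) ∧
      (∫ x, (v x ^ 2 + ‖gradient v x‖ ^ 2)) ≤
        K1 * (∫ x, (‖gradient v x‖ ^ 2 + V x * v x ^ 2)) + K2 * (∫ x, v x * φ x) ^ 2 := by
  obtain ⟨C, hC, hgap⟩ := gap hVm hM hR hc hV hφ hpos hφm heq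
  have hM0 : 0 ≤ M := (abs_nonneg _).trans (hM 0)
  have hΦ : 0 < ∫ x, φ x ^ 2 := by
    refine integral_pos_of_integrable_nonneg_nonzero (x := 0) (hφ.continuous.pow 2)
      hφm.integrable_sq (fun x => sq_nonneg _) ?_
    exact pow_ne_zero 2 (hpos 0).ne'
  refine ⟨1 + (1 + M) * C, (1 + M) / ∫ x, φ x ^ 2, by positivity, by positivity,
    fun v hv hv2 hvg => ?_⟩
  obtain ⟨h0, h1⟩ := hgap v hv hv2 hvg
  have iv : Integrable (fun x => v x ^ 2) := hv2.integrable_sq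
  have ig : Integrable (fun x => ‖gradient v x‖ ^ 2) :=
    (memLp_two_iff_integrable_sq_norm hvg.1).1 hvg
  have iV := int_bdd_mul hVm hM iv
  have hA : 0 ≤ ∫ x, v x ^ 2 := integral_nonneg fun x => sq_nonneg _
  have hG : 0 ≤ ∫ x, ‖gradient v x‖ ^ 2 := integral_nonneg fun x => sq_nonneg _
  have up : ∫ x, V x * v x ^ 2 ≤ M * ∫ x, v x ^ 2 := by
    rw [← integral_const_mul]
    exact integral_mono iV (iv.const_mul M) fun x =>
      mul_le_mul_of_nonneg_right (abs_le.1 (hM x)).2 (sq_nonneg _)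
  have lo : -M * ∫ x, v x ^ 2 ≤ ∫ x, V x * v x ^ 2 := by
    rw [← integral_const_mul]
    exact integral_mono (iv.const_mul (-M)) iV fun x =>
      mul_le_mul_of_nonneg_right (abs_le.1 (hM x)).1 (sq_nonneg _)
  have eQ : ∫ x, (‖gradient v x‖ ^ 2 + V x * v x ^ 2)
      = (∫ x, ‖gradient v x‖ ^ 2) + ∫ x, V x * v x ^ 2 := integral_add ig iV
  have eH : ∫ x, (v x ^ 2 + ‖gradient v x‖ ^ 2)
      = (∫ x, v x ^ 2) + ∫ x, ‖gradient v x‖ ^ 2 := integral_add iv ig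
  refine ⟨h0, ?_, ?_⟩
  · rw [eQ, eH]
    nlinarith
  · have h2 : ∫ x, v x ^ 2 ≤ C * (∫ x, (‖gradient v x‖ ^ 2 + V x * v x ^ 2))
        + (∫ x, v x * φ x) ^ 2 / ∫ x, φ x ^ 2 := by
      rw [← sub_le_iff_le_add', le_div_iff₀ hΦ]
      linarith
    have h3 := mul_le_mul_of_nonneg_left h2 (by linarith : 0 ≤ 1 + M)
    rw [eH]
    have e : (1 + M) / (∫ x, φ x ^ 2) * (∫ x, v x * φ x) ^ 2
      = (1 + M) * ((∫ x, v x * φ x) ^ 2 / ∫ x, φ x ^ 2) := by ring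
    rw [e]
    linarith

lemma coer2 {V φ : (EuclideanSpace ℝ (Fin N)) → ℝ} (hVm : Measurable V) {M : ℝ} (hM : ∀ x, |V x| ≤ M)
    {K1 K2 : ℝ} (hK1 : 0 < K1)
    {v : (EuclideanSpace ℝ (Fin N)) → ℝ} (hv : ContDiff ℝ 2 v) (hv2 : MemLp v 2 volume)
    (hvg : MemLp (fun x => gradient v x) 2 volume) (hvl : MemLp (fun x => lap v x) 2 volume)
    (h : (∫ x, (v x ^ 2 + ‖gradient v x‖ ^ 2)) ≤
        K1 * (∫ x, (‖gradient v x‖ ^ 2 + V x * v x ^ 2)) + K2 * (∫ x, v x * φ x) ^ 2) :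
    ∫ x, (v x ^ 2 + ‖gradient v x‖ ^ 2 + (lap v x) ^ 2) ≤
      ((1 + 2 * M ^ 2) * K1 ^ 2 + 2) * (∫ x, (-(lap v x) + V x * v x) ^ 2)
        + 2 * (1 + 2 * M ^ 2) * K2 * (∫ x, v x * φ x) ^ 2 := by
  have iv : Integrable (fun x => v x ^ 2) := hv2.integrable_sq
  have ig : Integrable (fun x => ‖gradient v x‖ ^ 2) :=
    (memLp_two_iff_integrable_sq_norm hvg.1).1 hvg
  have iV := int_bdd_mul hVm hM iv
  have il : Integrable (fun x => lap v x ^ 2) := hvl.integrable_sq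
  have ivl : Integrable (fun x => v x * lap v x) := hv2.integrable_mul hvl
  have hVsq : ∀ x, V x ^ 2 ≤ M ^ 2 := fun x => by
    rw [← sq_abs]; exact pow_le_pow_left₀ (abs_nonneg _) (hM x) 2
  have iL : Integrable (fun x => (-(lap v x) + V x * v x) ^ 2) := by
    refine Integrable.mono' ((il.const_mul 2).add (iv.const_mul (2 * M ^ 2))) ?_ ?_
    · exact (((cont_lap hv).measurable.neg.add
        (hVm.mul hv.continuous.measurable)).pow_const 2).aestronglyMeasurable
    · refine ae_of_all _ fun x => ?_
      rw [Real.norm_of_nonneg (sq_nonneg _)]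
      simp only [Pi.add_apply]
      nlinarith [sq_nonneg (lap v x + V x * v x),
        mul_le_mul_of_nonneg_right (hVsq x) (sq_nonneg (v x))]
  have hA : 0 ≤ ∫ x, v x ^ 2 := integral_nonneg fun x => sq_nonneg _
  have hG : 0 ≤ ∫ x, ‖gradient v x‖ ^ 2 := integral_nonneg fun x => sq_nonneg _
  have eQ : ∫ x, (‖gradient v x‖ ^ 2 + V x * v x ^ 2)
      = ∫ x, v x * (-(lap v x) + V x * v x) := by
    have : ∀ x, v x * (-(lap v x) + V x * v x) = V x * v x ^ 2 - v x * lap v x := fun x => by ring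
    simp_rw [this]
    rw [integral_add ig iV, integral_sub iV ivl, green hv hv2 hvg hvl]
    ring
  have hq : K1 * (∫ x, (‖gradient v x‖ ^ 2 + V x * v x ^ 2))
      ≤ 1 / 2 * (∫ x, v x ^ 2) + K1 ^ 2 / 2 * ∫ x, (-(lap v x) + V x * v x) ^ 2 := by
    rw [eQ, ← integral_const_mul, ← integral_const_mul, ← integral_const_mul,
      ← integral_add (iv.const_mul _) (iL.const_mul _)]
    have i6 : Integrable (fun x => v x * (-(lap v x) + V x * v x)) := by
      have : ∀ x, v x * (-(lap v x) + V x * v x) = V x * v x ^ 2 - v x * lap v x :=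
        fun x => by ring
      simp_rw [this]
      exact iV.sub ivl
    refine integral_mono (i6.const_mul K1) ((iv.const_mul _).add (iL.const_mul _)) fun x => ?_
    simp only [Pi.add_apply]
    nlinarith [sq_nonneg (v x - K1 * (-(lap v x) + V x * v x))]
  have hl : ∫ x, lap v x ^ 2
      ≤ 2 * M ^ 2 * (∫ x, v x ^ 2) + 2 * ∫ x, (-(lap v x) + V x * v x) ^ 2 := by
    rw [← integral_const_mul, ← integral_const_mul,
      ← integral_add (iv.const_mul _) (iL.const_mul _)]
    refine integral_mono il ((iv.const_mul _).add (iL.const_mul _)) fun x => ?_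
    simp only [Pi.add_apply]
    nlinarith [sq_nonneg (2 * (V x * v x) - lap v x),
        mul_le_mul_of_nonneg_right (hVsq x) (sq_nonneg (v x))]
  have eH : ∫ x, (v x ^ 2 + ‖gradient v x‖ ^ 2)
      = (∫ x, v x ^ 2) + ∫ x, ‖gradient v x‖ ^ 2 := integral_add iv ig
  have eH2 : ∫ x, (v x ^ 2 + ‖gradient v x‖ ^ 2 + (lap v x) ^ 2)
      = (∫ x, (v x ^ 2 + ‖gradient v x‖ ^ 2)) + ∫ x, lap v x ^ 2 := integral_add (iv.add ig) il
  rw [eH2]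
  rw [eH] at h ⊢
  generalize (∫ x, (‖gradient v x‖ ^ 2 + V x * v x ^ 2)) = q at *
  generalize (∫ x, v x ^ 2) = A at *
  generalize (∫ x, ‖gradient v x‖ ^ 2) = G at *
  generalize (∫ x, (-(lap v x) + V x * v x) ^ 2) = S at *
  generalize (∫ x, lap v x ^ 2) = H at *
  generalize (∫ x, v x * φ x) ^ 2 = P at *
  have h1 : A + G ≤ K1 ^ 2 * S + 2 * (K2 * P) := by linarith
  have h2 : A ≤ K1 ^ 2 * S + 2 * (K2 * P) := by linarith
  have h3 := mul_le_mul_of_nonneg_left h2 (by positivity : 0 ≤ 2 * M ^ 2)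
  linarith

end SchrCoer

/-- coercivity of the Schrödinger operator L = −Δ + V on ℝ^N admitting a
    positive kernel element φ. -/
theorem schrodinger_coercivity (N : ℕ) (hN : 1 ≤ N)
    (V : EuclideanSpace ℝ (Fin N) → ℝ) (hVmeas : Measurable V) (hVbdd : ∃ M : ℝ, ∀ x, |V x| ≤ M)
    (hVpos : ∃ R c : ℝ, 0 < R ∧ 0 < c ∧ ∀ x, R ≤ ‖x‖ → c ≤ V x)
    (φ : EuclideanSpace ℝ (Fin N) → ℝ) (hφreg : ContDiff ℝ 2 φ) (hφpos : ∀ x, 0 < φ x)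
    (hφ2 : MemLp φ 2 volume) (hφg : MemLp (fun x => gradient φ x) 2 volume)
    (hφeq : ∀ x, -(lap φ x) + V x * φ x = 0) :
    -- (i) nonnegativity of the quadratic form
    (∀ v : EuclideanSpace ℝ (Fin N) → ℝ, ContDiff ℝ 1 v →
      MemLp v 2 volume → MemLp (fun x => gradient v x) 2 volume →
      0 ≤ ∫ x, (‖gradient v x‖ ^ 2 + V x * (v x) ^ 2)) ∧
    -- (ii) the kernel is spanned by φ
    (∀ v : EuclideanSpace ℝ (Fin N) → ℝ, ContDiff ℝ 2 v →
      MemLp v 2 volume → MemLp (fun x => gradient v x) 2 volume →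
      (∀ x, -(lap v x) + V x * v x = 0) →
      ∃ a : ℝ, ∀ x, v x = a * φ x) ∧
    -- (iii) coercivity up to the direction φ
    (∃ lam : ℝ, 0 < lam ∧
      (∀ v : EuclideanSpace ℝ (Fin N) → ℝ, ContDiff ℝ 1 v →
        MemLp v 2 volume → MemLp (fun x => gradient v x) 2 volume →
        (∫ x, (‖gradient v x‖ ^ 2 + V x * (v x) ^ 2))
          ≤ (1 / lam) * ∫ x, ((v x) ^ 2 + ‖gradient v x‖ ^ 2) ∧
        4 * lam * (∫ x, ((v x) ^ 2 + ‖gradient v x‖ ^ 2))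
            - (1 / lam) * (∫ x, v x * φ x) ^ 2
          ≤ ∫ x, (‖gradient v x‖ ^ 2 + V x * (v x) ^ 2)) ∧
      (∀ v : EuclideanSpace ℝ (Fin N) → ℝ, ContDiff ℝ 2 v →
        MemLp v 2 volume → MemLp (fun x => gradient v x) 2 volume →
        MemLp (fun x => lap v x) 2 volume →
        4 * lam * (∫ x, ((v x) ^ 2 + ‖gradient v x‖ ^ 2 + (lap v x) ^ 2))
            - (1 / lam) * (∫ x, v x * φ x) ^ 2
          ≤ ∫ x, (-(lap v x) + V x * v x) ^ 2)) := by
  obtain ⟨M, hM⟩ := hVbdd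
  obtain ⟨R, c, hR, hc, hV⟩ := hVpos
  have hM0 : 0 ≤ M := (abs_nonneg _).trans (hM 0)
  obtain ⟨K1, K2, hK1, hK2, H⟩ := SchrCoer.coer hVmeas hM hR hc hV hφreg hφpos hφ2 hφeq
  have H2 := fun (v : EuclideanSpace ℝ (Fin N) → ℝ) (hv : ContDiff ℝ 2 v)
      (hv2 : MemLp v 2 volume) (hvg : MemLp (fun x => gradient v x) 2 volume)
      (hvl : MemLp (fun x => lap v x) 2 volume) =>
    SchrCoer.coer2 hVmeas hM hK1 hv hv2 hvg hvl (H v (hv.of_le (by norm_num)) hv2 hvg).2.2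
  have hφl : MemLp (fun x => lap φ x) 2 volume := by
    refine MemLp.of_le_mul (c := M) hφ2 (SchrCoer.cont_lap hφreg).aestronglyMeasurable ?_
    refine ae_of_all _ fun x => ?_
    rw [show lap φ x = V x * φ x by linarith [hφeq x], norm_mul]
    exact mul_le_mul_of_nonneg_right (hM x) (norm_nonneg _)
  refine ⟨fun v hv hv2 hvg => (H v hv hv2 hvg).1, ?_, ?_⟩
  · intro v hv hv2 hvg hveq
    have iφ : Integrable (fun x => φ x ^ 2) := hφ2.integrable_sq
    have ivφ : Integrable (fun x => v x * φ x) := hv2.integrable_mul hφ2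
    have hΦ : 0 < ∫ x, φ x ^ 2 := by
      refine integral_pos_of_integrable_nonneg_nonzero (x := 0) (hφreg.continuous.pow 2)
        iφ (fun x => sq_nonneg _) ?_
      exact pow_ne_zero 2 (hφpos 0).ne'
    have hvl : MemLp (fun x => lap v x) 2 volume := by
      refine MemLp.of_le_mul (c := M) hv2 (SchrCoer.cont_lap hv).aestronglyMeasurable ?_
      refine ae_of_all _ fun x => ?_
      rw [show lap v x = V x * v x by linarith [hveq x], norm_mul]
      exact mul_le_mul_of_nonneg_right (hM x) (norm_nonneg _)
    obtain ⟨a, ha⟩ : ∃ a : ℝ, a = (∫ x, v x * φ x) / ∫ x, φ x ^ 2 := ⟨_, rfl⟩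
    refine ⟨a, ?_⟩
    have hφ1 : ContDiff ℝ 1 φ := hφreg.of_le (by norm_num)
    have hv1 : ContDiff ℝ 1 v := hv.of_le (by norm_num)
    have haφ : ContDiff ℝ 2 (fun x => a * φ x) := contDiff_const.mul hφreg
    have hu : ContDiff ℝ 2 (fun x => v x - a * φ x) := hv.sub haφ
    have hu2 : MemLp (fun x => v x - a * φ x) 2 volume := hv2.sub (hφ2.const_mul a)
    have hgu : (fun x => gradient (fun x => v x - a * φ x) x)
        = fun x => gradient v x - a • gradient φ x := by
      ext1 x
      rw [SchrCoer.grad_sub (hv1.differentiable one_ne_zero x)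
        (haφ.differentiable two_ne_zero x),
        SchrCoer.grad_mul (differentiableAt_const a) (hφ1.differentiable one_ne_zero x)]
      simp
    have hug : MemLp (fun x => gradient (fun x => v x - a * φ x) x) 2 volume := by
      rw [hgu]
      exact hvg.sub (hφg.const_smul a)
    have hlu : ∀ x, lap (fun x => v x - a * φ x) x = lap v x - a * lap φ x := fun x => by
      rw [SchrCoer.lap_sub hv haφ, SchrCoer.lap_const_mul hφreg]
    have hul : MemLp (fun x => lap (fun x => v x - a * φ x) x) 2 volume := by
      simp_rw [hlu]
      exact hvl.sub (hφl.const_mul a)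
    have key := H2 _ hu hu2 hug hul
    have hP : ∫ x, (v x - a * φ x) * φ x = 0 := by
      have : ∀ x, (v x - a * φ x) * φ x = v x * φ x - a * φ x ^ 2 := fun x => by ring
      simp_rw [this]
      rw [integral_sub ivφ (iφ.const_mul a), integral_const_mul, ha, div_mul_cancel₀ _ hΦ.ne',
        sub_self]
    have hL : ∀ x, -(lap (fun x => v x - a * φ x) x) + V x * (v x - a * φ x) = 0 := fun x => by
      rw [hlu]
      linear_combination hveq x - a * hφeq x
    simp only [hL, hP] at key
    have iu : Integrable (fun x => (v x - a * φ x) ^ 2) := hu2.integrable_sq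
    have ig : Integrable (fun x => ‖gradient (fun x => v x - a * φ x) x‖ ^ 2) :=
      (memLp_two_iff_integrable_sq_norm hug.1).1 hug
    have il : Integrable (fun x => lap (fun x => v x - a * φ x) x ^ 2) := hul.integrable_sq
    have h0 : ∫ x, (v x - a * φ x) ^ 2 ≤ 0 := by
      refine le_trans (integral_mono iu ((iu.add ig).add il) fun x => ?_) (key.trans ?_)
      · simp only [Pi.add_apply]
        nlinarith [sq_nonneg ‖gradient (fun x => v x - a * φ x) x‖,
          sq_nonneg (lap (fun x => v x - a * φ x) x)]
      · simp
    intro x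
    by_contra hx
    have : 0 < ∫ x, (v x - a * φ x) ^ 2 := by
      refine integral_pos_of_integrable_nonneg_nonzero (x := x) (hu.continuous.pow 2)
        iu (fun x => sq_nonneg _) ?_
      exact pow_ne_zero 2 (sub_ne_zero.2 hx)
    linarith
  · obtain ⟨K3, hK3⟩ : ∃ K3 : ℝ, K3 = (1 + 2 * M ^ 2) * K1 ^ 2 + 2 := ⟨_, rfl⟩
    obtain ⟨K4, hK4⟩ : ∃ K4 : ℝ, K4 = 2 * (1 + 2 * M ^ 2) * K2 := ⟨_, rfl⟩
    have hK3p : 0 < K3 := by rw [hK3]; positivity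
    have hK4p : 0 < K4 := by rw [hK4]; positivity
    rw [← hK3, ← hK4] at H2
    obtain ⟨T, hT⟩ : ∃ T : ℝ, T = 4 * (1 + M + K1 + K2 + K3 + K4) := ⟨_, rfl⟩
    have hTp : 0 < T := by rw [hT]; positivity
    have gen : ∀ A B X Y P : ℝ, 0 ≤ X → 0 ≤ P → 0 < A → 0 < B → 4 * A ≤ T → 4 * B ≤ T → 1 ≤ T →
        Y ≤ A * X + B * P → 4 * (1 / T) * Y - 1 / (1 / T) * P ≤ X := by
      intro A B X Y P hX hP hA hB hAT hBT hT1 hY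
      rw [one_div_one_div]
      have h1 : 4 * Y ≤ T * X + T * P := by nlinarith
      have h2 : 4 * (1 / T) * Y ≤ X + P := by
        rw [show 4 * (1 / T) * Y = (4 * Y) / T by ring, div_le_iff₀ hTp]
        linarith
      nlinarith
    refine ⟨1 / T, by positivity, ?_, ?_⟩
    · intro v hv hv2 hvg
      obtain ⟨h0, h1, h2⟩ := H v hv hv2 hvg
      refine ⟨?_, gen K1 K2 _ _ _ h0 (sq_nonneg _) hK1 hK2 (by linarith) (by linarith)
        (by linarith) h2⟩
      rw [one_div_one_div]
      refine h1.trans (mul_le_mul_of_nonneg_right (by linarith) ?_)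
      exact integral_nonneg fun x => by positivity
    · intro v hv hv2 hvg hvl
      exact gen K3 K4 _ _ _ (integral_nonneg fun x => sq_nonneg _) (sq_nonneg _) hK3p hK4p
        (by linarith) (by linarith) (by linarith) (H2 v hv hv2 hvg hvl)
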